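/- Let R be a left and right coherent ring that is right IF but not left IF. Then l.Gwdim(R) = r.Gwdim(R) = ∞. -/

import Mathlib

/-!
Background definitions for D. Bennis, "Weak Gorenstein global dimensions".

Conventions.  All rings are associative with identity.  A *left* `R`-module is a type with
`[AddCommGroup M] [Module R M]`; a *right* `R`-module is a left module over the opposite ring,
i.e. `[Module Rᵐᵒᵖ M]`.  All "right-handed" notions below are obtained by applying the
corresponding "left-handed" notion to the opposite ring `Rᵐᵒᵖ`.
-/

open MulOpposite

universe u

section Tensor

variable (S : Type u) [Ring S]

/-- The subgroup of relations defining the tensor product `A ⊗_S M` of a right `S`-module `A`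
and a left `S`-module `M` over a (possibly noncommutative) ring `S`. -/
def tensorRels (A : Type u) [AddCommGroup A] [Module Sᵐᵒᵖ A]
    (M : Type u) [AddCommGroup M] [Module S M] :
    AddSubgroup (FreeAbelianGroup (A × M)) :=
  AddSubgroup.closure
    { x | (∃ a₁ a₂ m, x = FreeAbelianGroup.of (a₁ + a₂, m) - FreeAbelianGroup.of (a₁, m) -
            FreeAbelianGroup.of (a₂, m)) ∨
          (∃ a m₁ m₂, x = FreeAbelianGroup.of (a, m₁ + m₂) - FreeAbelianGroup.of (a, m₁) -
            FreeAbelianGroup.of (a, m₂)) ∨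
          (∃ (a : A) (r : S) (m : M), x = FreeAbelianGroup.of (op r • a, m) - FreeAbelianGroup.of (a, r • m)) }

/-- The tensor product `A ⊗_S M` (an abelian group) of a right `S`-module `A` and a left
`S`-module `M` over a (possibly noncommutative) ring `S`. -/
def NTensor (A : Type u) [AddCommGroup A] [Module Sᵐᵒᵖ A]
    (M : Type u) [AddCommGroup M] [Module S M] : Type u :=
  FreeAbelianGroup (A × M) ⧸ tensorRels S A M

instance (A : Type u) [AddCommGroup A] [Module Sᵐᵒᵖ A]
    (M : Type u) [AddCommGroup M] [Module S M] : AddCommGroup (NTensor S A M) :=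
  QuotientAddGroup.Quotient.addCommGroup _

namespace NTensor

variable {S}
variable {A A' : Type u} [AddCommGroup A] [Module Sᵐᵒᵖ A] [AddCommGroup A'] [Module Sᵐᵒᵖ A']
variable {M M' : Type u} [AddCommGroup M] [Module S M] [AddCommGroup M'] [Module S M']

/-- Functoriality of `A ⊗_S −` : the map `A ⊗_S M → A ⊗_S M'` induced by a linear map
`g : M → M'` of left `S`-modules. -/
def rmap (A : Type u) [AddCommGroup A] [Module Sᵐᵒᵖ A] (g : M →ₗ[S] M') :
    NTensor S A M →+ NTensor S A M' :=
  QuotientAddGroup.map (tensorRels S A M) (tensorRels S A M') (FreeAbelianGroup.map (Prod.map id g)) (by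
    simp only [tensorRels]
    refine (AddSubgroup.closure_le _).2 ?_
    rintro x (⟨a₁, a₂, m, rfl⟩ | ⟨a, m₁, m₂, rfl⟩ | ⟨a, r, m, rfl⟩) <;>
      refine SetLike.mem_coe.2 (AddSubgroup.mem_comap.2 (AddSubgroup.subset_closure ?_)) <;>
      simp only [map_sub, map_add, map_smul, FreeAbelianGroup.map_of_apply, Prod.map_apply,
        id_eq, Set.mem_setOf_eq]
    · exact Or.inl ⟨a₁, a₂, g m, rfl⟩
    · exact Or.inr (Or.inl ⟨a, g m₁, g m₂, rfl⟩)
    · exact Or.inr (Or.inr ⟨a, r, g m, rfl⟩))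

/-- Functoriality of `− ⊗_S M` : the map `A ⊗_S M → A' ⊗_S M` induced by a linear map
`f : A → A'` of right `S`-modules. -/
def lmap (M : Type u) [AddCommGroup M] [Module S M] (f : A →ₗ[Sᵐᵒᵖ] A') :
    NTensor S A M →+ NTensor S A' M :=
  QuotientAddGroup.map (tensorRels S A M) (tensorRels S A' M) (FreeAbelianGroup.map (Prod.map f id)) (by
    simp only [tensorRels]
    refine (AddSubgroup.closure_le _).2 ?_
    rintro x (⟨a₁, a₂, m, rfl⟩ | ⟨a, m₁, m₂, rfl⟩ | ⟨a, r, m, rfl⟩) <;>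
      refine SetLike.mem_coe.2 (AddSubgroup.mem_comap.2 (AddSubgroup.subset_closure ?_)) <;>
      simp only [map_sub, map_add, map_smul, FreeAbelianGroup.map_of_apply, Prod.map_apply,
        id_eq, Set.mem_setOf_eq]
    · exact Or.inl ⟨f a₁, f a₂, m, rfl⟩
    · exact Or.inr (Or.inl ⟨f a, m₁, m₂, rfl⟩)
    · exact Or.inr (Or.inr ⟨f a, r, m, rfl⟩))

end NTensor

end Tensor

section Dims

variable (S : Type u) [Ring S]

/-- A left `S`-module `M` is *flat* if tensoring with it preserves injectivity of maps of
right `S`-modules. -/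
def IsFlatMod (M : ModuleCat.{u} S) : Prop :=
  ∀ (A B : Type u) [AddCommGroup A] [Module Sᵐᵒᵖ A] [AddCommGroup B] [Module Sᵐᵒᵖ B]
    (f : A →ₗ[Sᵐᵒᵖ] B), Function.Injective f →
      Function.Injective (NTensor.lmap (↥M) f)

/-- A left `S`-module `M` is *Gorenstein flat* if there is an exact sequence
`⋯ → F (-1) → F 0 → F 1 → ⋯` of flat left `S`-modules with `M ≅ Im (F 0 → F 1)` which stays
exact after applying `I ⊗_S −` for every injective right `S`-module `I`
(a *complete flat resolution*). -/
def IsGorensteinFlat (M : ModuleCat.{u} S) : Prop :=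
  ∃ (F : ℤ → ModuleCat.{u} S) (d : ∀ n : ℤ, ↥(F n) →ₗ[S] ↥(F (n + 1))),
    (∀ n, IsFlatMod S (F n)) ∧
    (∀ n, Function.Exact (d n) (d (n + 1))) ∧
    Nonempty (↥M ≃ₗ[S] ↥(LinearMap.range (d 0))) ∧
    (∀ (I : Type u) [AddCommGroup I] [Module Sᵐᵒᵖ I], Module.Injective Sᵐᵒᵖ I →
      ∀ n, Function.Exact (NTensor.rmap I (d n)) (NTensor.rmap I (d (n + 1))))

/-- `gflatDimLE S n M` means `Gfd_S(M) ≤ n`: there is an exact sequence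
`0 → G_n → ⋯ → G_0 → M → 0` of left `S`-modules with all `G_i` Gorenstein flat. -/
def gflatDimLE : ℕ → ModuleCat.{u} S → Prop
  | 0, M => IsGorensteinFlat S M
  | n + 1, M => ∃ (K G : ModuleCat.{u} S) (ι : ↥K →ₗ[S] ↥G) (π : ↥G →ₗ[S] ↥M),
      Function.Injective ι ∧ Function.Surjective π ∧ Function.Exact ι π ∧
      IsGorensteinFlat S G ∧ gflatDimLE n K

/-- `flatDimLE S n M` means `fd_S(M) ≤ n`: there is an exact sequence
`0 → F_n → ⋯ → F_0 → M → 0` of left `S`-modules with all `F_i` flat. -/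
def flatDimLE : ℕ → ModuleCat.{u} S → Prop
  | 0, M => IsFlatMod S M
  | n + 1, M => ∃ (K F : ModuleCat.{u} S) (ι : ↥K →ₗ[S] ↥F) (π : ↥F →ₗ[S] ↥M),
      Function.Injective ι ∧ Function.Surjective π ∧ Function.Exact ι π ∧
      IsFlatMod S F ∧ flatDimLE n K

/-- `injDimLE S n M` means `id_S(M) ≤ n`: there is an exact sequence
`0 → M → I^0 → ⋯ → I^n → 0` of left `S`-modules with all `I^i` injective. -/
def injDimLE : ℕ → ModuleCat.{u} S → Prop
  | 0, M => Module.Injective S ↥M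
  | n + 1, M => ∃ (I C : ModuleCat.{u} S) (ι : ↥M →ₗ[S] ↥I) (π : ↥I →ₗ[S] ↥C),
      Function.Injective ι ∧ Function.Surjective π ∧ Function.Exact ι π ∧
      Module.Injective S ↥I ∧ injDimLE n C

/-- The Gorenstein flat dimension `Gfd_S(M) ∈ ℕ∞` of a left `S`-module `M`. -/
noncomputable def gflatDim (M : ModuleCat.{u} S) : ℕ∞ :=
  sInf {d : ℕ∞ | ∃ n : ℕ, d = n ∧ gflatDimLE S n M}

/-- The flat dimension `fd_S(M) ∈ ℕ∞` of a left `S`-module `M`. -/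
noncomputable def flatDim (M : ModuleCat.{u} S) : ℕ∞ :=
  sInf {d : ℕ∞ | ∃ n : ℕ, d = n ∧ flatDimLE S n M}

/-- The injective dimension `id_S(M) ∈ ℕ∞` of a left `S`-module `M`. -/
noncomputable def injDim (M : ModuleCat.{u} S) : ℕ∞ :=
  sInf {d : ℕ∞ | ∃ n : ℕ, d = n ∧ injDimLE S n M}

/-- The left weak Gorenstein global dimension
`l.Gwdim(S) = sup { Gfd_S(M) | M a left S-module }`.  The right weak Gorenstein global
dimension of `S` is `gorensteinWeakGlobalDim Sᵐᵒᵖ`. -/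
noncomputable def gorensteinWeakGlobalDim : ℕ∞ :=
  ⨆ M : ModuleCat.{u} S, gflatDim S M

/-- The left weak global dimension `sup { fd_S(M) | M a left S-module }`.  (By a classical
theorem it agrees with `weakGlobalDim Sᵐᵒᵖ`, and the common value is `wdim S`.) -/
noncomputable def weakGlobalDim : ℕ∞ :=
  ⨆ M : ModuleCat.{u} S, flatDim S M

/-- The left finitistic flat dimension
`l.FFD(S) = sup { fd_S(M) | M a left S-module with fd_S(M) < ∞ }`. -/
noncomputable def finitisticFlatDim : ℕ∞ :=
  sSup {d : ℕ∞ | d ≠ ⊤ ∧ ∃ M : ModuleCat.{u} S, flatDim S M = d}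

/-- The left finitistic Gorenstein flat dimension
`l.FGFD(S) = sup { Gfd_S(M) | M a left S-module with Gfd_S(M) < ∞ }`. -/
noncomputable def finitisticGFlatDim : ℕ∞ :=
  sSup {d : ℕ∞ | d ≠ ⊤ ∧ ∃ M : ModuleCat.{u} S, gflatDim S M = d}

/-- A ring `S` is *left GF-closed* if the class of Gorenstein flat left `S`-modules is closed
under extensions.  `S` is right GF-closed iff `Sᵐᵒᵖ` is left GF-closed, and GF-closed if both. -/
def IsGFClosed : Prop :=
  ∀ (A B C : ModuleCat.{u} S) (f : ↥A →ₗ[S] ↥B) (g : ↥B →ₗ[S] ↥C),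
    Function.Injective f → Function.Surjective g → Function.Exact f g →
      IsGorensteinFlat S A → IsGorensteinFlat S C → IsGorensteinFlat S B

/-- A ring `S` is *left coherent* if every finitely generated left ideal of `S` is finitely
presented (as a left `S`-module).  `S` is right coherent iff `Sᵐᵒᵖ` is left coherent. -/
def IsLeftCoherent : Prop :=
  ∀ I : Submodule S S, I.FG → Module.FinitePresentation S ↥I

/-- A ring `S` is *left IF* if every injective left `S`-module is flat.  `S` is right IF iff
`Sᵐᵒᵖ` is left IF, and IF if both. -/
def IsLeftIF : Prop :=
  ∀ E : ModuleCat.{u} S, Module.Injective S ↥E → IsFlatMod S E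

/-- A ring `S` is *left `n`-IF* if `fd_S(E) ≤ n` for every injective left `S`-module `E`.
`S` is right `n`-IF iff `Sᵐᵒᵖ` is left `n`-IF, and `n`-IF if both. -/
def IsLeftNIF (n : ℕ) : Prop :=
  ∀ E : ModuleCat.{u} S, Module.Injective S ↥E → flatDim S E ≤ (n : ℕ∞)

/-- `Ext¹_S(T, K) = 0`, expressed by its standard characterization: every extension of `T`
by `K` (i.e. every short exact sequence `0 → K → X → T → 0`) splits. -/
def Ext1Zero (T K : ModuleCat.{u} S) : Prop :=
  ∀ (X : ModuleCat.{u} S) (ι : ↥K →ₗ[S] ↥X) (π : ↥X →ₗ[S] ↥T),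
    Function.Injective ι → Function.Surjective π → Function.Exact ι π →
      ∃ ρ : ↥X →ₗ[S] ↥K, ρ.comp ι = LinearMap.id

/-- A left `S`-module `K` is *cotorsion* if `Ext¹_S(F, K) = 0` for every flat left
`S`-module `F`. -/
def IsCotorsion (K : ModuleCat.{u} S) : Prop :=
  ∀ F : ModuleCat.{u} S, IsFlatMod S F → Ext1Zero S F K

/-- `Tor₁^S(A, T) = 0` for a right `S`-module `A` and a left `S`-module `T`, expressed by its
standard characterization: for every short exact sequence `0 → K → F → T → 0` of left
`S`-modules with `F` flat, the induced map `A ⊗_S K → A ⊗_S F` is injective. -/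
def Tor1Zero (A : Type u) [AddCommGroup A] [Module Sᵐᵒᵖ A] (T : ModuleCat.{u} S) : Prop :=
  ∀ (K F : ModuleCat.{u} S) (ι : ↥K →ₗ[S] ↥F) (π : ↥F →ₗ[S] ↥T),
    IsFlatMod S F → Function.Injective ι → Function.Surjective π → Function.Exact ι π →
      Function.Injective (NTensor.rmap A ι)

/-- A left `S`-module is *finitely presented* if it admits a presentation with finitely many
generators and relations. -/
abbrev IsFinitelyPresented (M : ModuleCat.{u} S) : Prop :=
  Module.FinitePresentation S ↥M

end Dims

noncomputable section

namespace CharacterModule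

section Action

variable {S : Type u} [Ring S] {M N : Type u} [AddCommGroup M] [AddCommGroup N]

/-- The character module of a left module is a right module. -/
instance moduleOp [Module S M] : Module Sᵐᵒᵖ (CharacterModule M) where
  smul s c := AddMonoidHom.comp c (DistribSMul.toAddMonoidHom M s.unop)
  one_smul c := by ext x; exact congrArg c (one_smul S x)
  mul_smul s t c := by ext x; exact congrArg c (mul_smul t.unop s.unop x)
  smul_zero s := rfl
  smul_add s c c' := rfl
  add_smul s t c := by
    ext x
    exact (congrArg c (add_smul s.unop t.unop x)).trans (map_add c _ _)
  zero_smul c := by ext x; exact (congrArg c (zero_smul S x)).trans (map_zero c)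

/-- The character module of a right module is a left module. -/
instance moduleOfOp [Module Sᵐᵒᵖ M] : Module S (CharacterModule M) where
  smul s c := AddMonoidHom.comp c (DistribSMul.toAddMonoidHom M (op s))
  one_smul c := by ext x; exact congrArg c (one_smul Sᵐᵒᵖ x)
  mul_smul s t c := by ext x; exact congrArg c (mul_smul (op t) (op s) x)
  smul_zero s := rfl
  smul_add s c c' := rfl
  add_smul s t c := by
    ext x
    exact (congrArg c (add_smul (op s) (op t) x)).trans (map_add c _ _)
  zero_smul c := by ext x; exact (congrArg c (zero_smul Sᵐᵒᵖ x)).trans (map_zero c)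

theorem op_smul_apply' [Module S M] (s : Sᵐᵒᵖ) (c : CharacterModule M) (x : M) :
    (s • c) x = c (s.unop • x) := rfl

theorem smul_apply_op [Module Sᵐᵒᵖ M] (s : S) (c : CharacterModule M) (x : M) :
    (s • c) x = c (op s • x) := rfl

theorem add_apply' (c c' : CharacterModule M) (x : M) : (c + c') x = c x + c' x := rfl

theorem sub_apply' (c c' : CharacterModule M) (x : M) : (c - c') x = c x - c' x := rfl

theorem sum_apply {ι : Type*} (s : Finset ι) (c : ι → CharacterModule M) (x : M) :
    (∑ i ∈ s, c i) x = ∑ i ∈ s, c i x :=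
  map_sum (AddMonoidHom.eval x : (M →+ AddCircle (1 : ℚ)) →+ AddCircle (1 : ℚ)) c s

/-- Precomposition with a map of left modules, as a map of right modules. -/
def dualOp [Module S M] [Module S N] (f : M →ₗ[S] N) :
    CharacterModule N →ₗ[Sᵐᵒᵖ] CharacterModule M where
  toFun c := AddMonoidHom.comp c f.toAddMonoidHom
  map_add' _ _ := rfl
  map_smul' s c := by ext x; exact congrArg c (map_smul f s.unop x).symm

theorem dualOp_apply [Module S M] [Module S N] (f : M →ₗ[S] N) (c : CharacterModule N) (x : M) :
    dualOp f c x = c (f x) := rfl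

/-- The evaluation map of a left module into its double character module. -/
def evalDouble (S : Type u) [Ring S] (M : Type u) [AddCommGroup M] [Module S M] :
    M →ₗ[S] CharacterModule (CharacterModule M) where
  toFun x := (AddMonoidHom.eval x : (M →+ AddCircle (1 : ℚ)) →+ AddCircle (1 : ℚ))
  map_add' x y := by ext c; exact map_add c x y
  map_smul' s x := by ext c; rfl

theorem evalDouble_apply [Module S M] (x : M) (c : CharacterModule M) :
    evalDouble S M x c = c x := rfl

theorem evalDouble_injective [Module S M] : Function.Injective (evalDouble S M) := by
  refine (injective_iff_map_eq_zero _).2 fun x hx => eq_zero_of_character_apply fun c => ?_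
  rw [← evalDouble_apply (S := S), hx]
  rfl

end Action

/-- Characters extend along injective homomorphisms of abelian groups. -/
theorem exists_extension {A B : Type u} [AddCommGroup A] [AddCommGroup B] (f : A →+ B)
    (hf : Function.Injective f) (c : CharacterModule A) :
    ∃ c' : CharacterModule B, ∀ x, c' (f x) = c x := by
  obtain ⟨c', hc'⟩ := dual_surjective_of_injective f.toIntLinearMap hf c
  exact ⟨c', fun x => DFunLike.congr_fun hc' x⟩

/-- A homomorphism vanishing on the kernel of `f` factors, after extension, through `f`. -/
theorem exists_factor {A B : Type u} [AddCommGroup A] [AddCommGroup B] (f : A →+ B)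
    (c : CharacterModule A) (h : ∀ x, f x = 0 → c x = 0) :
    ∃ c' : CharacterModule B, ∀ x, c' (f x) = c x := by
  obtain ⟨c', hc'⟩ := exists_extension (QuotientAddGroup.kerLift f)
    (QuotientAddGroup.kerLift_injective f)
    (QuotientAddGroup.lift f.ker c fun x hx => h x hx : A ⧸ f.ker →+ AddCircle (1 : ℚ))
  exact ⟨c', fun x => hc' (QuotientAddGroup.mk x)⟩

end CharacterModule

namespace NTensor

variable {S : Type u} [Ring S] {A B M N : Type u} [AddCommGroup A] [Module Sᵐᵒᵖ A]
  [AddCommGroup B] [Module Sᵐᵒᵖ B] [AddCommGroup M] [Module S M] [AddCommGroup N] [Module S N]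

/-- The pure tensor `a ⊗ m`. -/
def tmul (a : A) (m : M) : NTensor S A M :=
  QuotientAddGroup.mk (FreeAbelianGroup.of (a, m))

theorem tmul_eq_of_mem {x y : FreeAbelianGroup (A × M)}
    (h : x - y ∈ tensorRels S A M) :
    (QuotientAddGroup.mk x : FreeAbelianGroup (A × M) ⧸ tensorRels S A M) =
      QuotientAddGroup.mk y :=
  (QuotientAddGroup.eq_iff_sub_mem).2 h

theorem add_tmul (a a' : A) (m : M) :
    (tmul (a + a') m : NTensor S A M) = tmul a m + tmul a' m :=
  tmul_eq_of_mem (AddSubgroup.subset_closure (Or.inl ⟨a, a', m, sub_add_eq_sub_sub _ _ _⟩))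

theorem tmul_add (a : A) (m m' : M) :
    (tmul a (m + m') : NTensor S A M) = tmul a m + tmul a m' :=
  tmul_eq_of_mem
    (AddSubgroup.subset_closure (Or.inr (Or.inl ⟨a, m, m', sub_add_eq_sub_sub _ _ _⟩)))

theorem smul_tmul (s : S) (a : A) (m : M) :
    (tmul (op s • a) m : NTensor S A M) = tmul a (s • m) :=
  tmul_eq_of_mem (AddSubgroup.subset_closure (Or.inr (Or.inr ⟨a, s, m, rfl⟩)))

/-- A right linear map into a character module induces a character of the tensor product. -/
def lift (f : A →ₗ[Sᵐᵒᵖ] CharacterModule M) : CharacterModule (NTensor S A M) :=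
  QuotientAddGroup.lift (tensorRels S A M) (FreeAbelianGroup.lift fun p => f p.1 p.2) (by
    refine (AddSubgroup.closure_le _).2 ?_
    rintro x (⟨a₁, a₂, m, rfl⟩ | ⟨a, m₁, m₂, rfl⟩ | ⟨a, r, m, rfl⟩)
    · simp [CharacterModule.add_apply']
    · simp
    · simp [CharacterModule.op_smul_apply'])

theorem lift_tmul (f : A →ₗ[Sᵐᵒᵖ] CharacterModule M) (a : A) (m : M) :
    lift f (tmul a m) = f a m :=
  FreeAbelianGroup.lift_apply_of _ _

theorem lmap_tmul (f : A →ₗ[Sᵐᵒᵖ] B) (a : A) (m : M) :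
    lmap M f (tmul a m) = tmul (f a) m :=
  congrArg QuotientAddGroup.mk (FreeAbelianGroup.map_of_apply _)

theorem rmap_tmul (g : M →ₗ[S] N) (a : A) (m : M) :
    rmap A g (tmul a m) = tmul a (g m) :=
  congrArg QuotientAddGroup.mk (FreeAbelianGroup.map_of_apply _)

theorem induction_on {p : NTensor S A M → Prop} (x : NTensor S A M) (zero : p 0)
    (tmul : ∀ a m, p (tmul a m)) (neg : ∀ x, p x → p (-x))
    (add : ∀ x y, p x → p y → p (x + y)) : p x := by
  induction x using QuotientAddGroup.induction_on with
  | H z =>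
    induction z using FreeAbelianGroup.induction_on with
    | zero => exact zero
    | of q => exact tmul q.1 q.2
    | neg q hq => exact neg _ hq
    | add x y hx hy => exact add _ _ hx hy

theorem characterModule_congr {c c' : CharacterModule (NTensor S A M)}
    (h : ∀ a m, c (tmul a m) = c' (tmul a m)) : c = c' := by
  ext x
  induction x using induction_on with
  | zero => rw [map_zero, map_zero]
  | tmul a m => exact h a m
  | neg x hx => rw [map_neg, map_neg, hx]
  | add x y hx hy => rw [map_add, map_add, hx, hy]

/-- A character of the tensor product, as a right linear map into a character module. -/
def curry (c : CharacterModule (NTensor S A M)) : A →ₗ[Sᵐᵒᵖ] CharacterModule M where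
  toFun a := AddMonoidHom.mk' (fun m => c (tmul a m)) fun m m' => by rw [tmul_add, map_add]
  map_add' a a' := by
    ext m
    exact (congrArg c (add_tmul a a' m)).trans (map_add c _ _)
  map_smul' s a := by
    ext m
    exact congrArg c (smul_tmul s.unop a m)

theorem curry_apply (c : CharacterModule (NTensor S A M)) (a : A) (m : M) :
    curry c a m = c (tmul a m) := rfl

/-- A character of the tensor product, as a left linear map into a character module. -/
def curryRight (c : CharacterModule (NTensor S A M)) : M →ₗ[S] CharacterModule A where
  toFun m := AddMonoidHom.mk' (fun a => c (tmul a m)) fun a a' => by rw [add_tmul, map_add]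
  map_add' m m' := by
    ext a
    exact (congrArg c (tmul_add a m m')).trans (map_add c _ _)
  map_smul' s m := by
    ext a
    exact congrArg c (smul_tmul s a m).symm

theorem curryRight_apply (c : CharacterModule (NTensor S A M)) (a : A) (m : M) :
    curryRight c m a = c (tmul a m) := rfl

/-- A left linear map into a character module induces a character of the tensor product. -/
def liftRight (f : M →ₗ[S] CharacterModule A) : CharacterModule (NTensor S A M) :=
  lift
    { toFun a := AddMonoidHom.mk' (fun m => f m a) fun m m' => by
        rw [map_add, CharacterModule.add_apply']
      map_add' a a' := by ext m; exact map_add (f m) a a'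
      map_smul' s a := by
        ext m
        exact (DFunLike.congr_fun (map_smul f s.unop m) a).symm }

theorem liftRight_tmul (f : M →ₗ[S] CharacterModule A) (a : A) (m : M) :
    liftRight f (tmul a m) = f m a :=
  lift_tmul _ a m

end NTensor

/-- A left module is flat if and only if its character module is injective. -/
theorem isFlatMod_iff_injective_characterModule {S : Type u} [Ring S] (M : ModuleCat.{u} S) :
    IsFlatMod S M ↔ Module.Injective Sᵐᵒᵖ (CharacterModule M) := by
  constructor
  · intro h
    refine ⟨fun A B _ _ _ _ f hf g => ?_⟩
    obtain ⟨c, hc⟩ := CharacterModule.exists_extension (NTensor.lmap M f) (h A B f hf)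
      (NTensor.lift g)
    refine ⟨NTensor.curry c, fun a => ?_⟩
    ext m
    rw [NTensor.curry_apply, ← NTensor.lmap_tmul, hc, NTensor.lift_tmul]
  · intro h A B _ _ _ _ f hf
    refine (injective_iff_map_eq_zero _).2 fun x hx =>
      CharacterModule.eq_zero_of_character_apply fun c => ?_
    obtain ⟨g, hg⟩ := h.out f hf (NTensor.curry c)
    have key : CharacterModule.dual (NTensor.lmap (↥M) f).toIntLinearMap (NTensor.lift g) = c := by
      refine NTensor.characterModule_congr fun a m => ?_
      rw [CharacterModule.dual_apply]
      change NTensor.lift g (NTensor.lmap (↥M) f (NTensor.tmul a m)) = _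
      rw [NTensor.lmap_tmul, NTensor.lift_tmul, hg, NTensor.curry_apply]
    rw [← key]
    change NTensor.lift g (NTensor.lmap (↥M) f x) = 0
    rw [hx, map_zero]

/-- A map out of the source of `f` vanishing on the kernel of `f` factors through `f`, if it goes
to an injective module. -/
theorem Module.Injective.exists_factor {S : Type u} [Ring S] {Q X Y : Type u} [AddCommGroup Q]
    [Module S Q] [AddCommGroup X] [Module S X] [AddCommGroup Y] [Module S Y]
    (hQ : Module.Injective S Q) (f : X →ₗ[S] Y) (g : X →ₗ[S] Q)
    (h : LinearMap.ker f ≤ LinearMap.ker g) : ∃ k : Y →ₗ[S] Q, ∀ x, k (f x) = g x := by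
  obtain ⟨k, hk⟩ := hQ.out ((LinearMap.ker f).liftQ f le_rfl)
    (LinearMap.ker_eq_bot.1 (Submodule.ker_liftQ_eq_bot _ _ _ le_rfl))
    ((LinearMap.ker f).liftQ g h)
  exact ⟨k, fun x => by simpa using hk (Submodule.Quotient.mk x)⟩

/-- A retract of an injective module is injective. -/
theorem Module.Injective.of_retract {S : Type u} [Ring S] {P Q : Type u} [AddCommGroup Q]
    [Module S Q] [AddCommGroup P] [Module S P] (hQ : Module.Injective S Q) (i : P →ₗ[S] Q)
    (r : Q →ₗ[S] P) (h : ∀ x, r (i x) = x) : Module.Injective S P := by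
  refine ⟨fun X Y _ _ _ _ f hf g => ?_⟩
  obtain ⟨k, hk⟩ := hQ.out f hf (i.comp g)
  exact ⟨r.comp k, fun x => by simp [hk, h]⟩

/-- Injectivity over `Sᵐᵒᵖᵐᵒᵖ` implies injectivity over `S`, for compatible actions. -/
theorem Module.Injective.of_opOp {S : Type u} [Ring S] {Q : Type u} [AddCommGroup Q]
    [Module S Q] [Module Sᵐᵒᵖᵐᵒᵖ Q] (hc : ∀ (s : S) (x : Q), op (op s) • x = s • x)
    (hQ : Module.Injective Sᵐᵒᵖᵐᵒᵖ Q) : Module.Injective S Q := by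
  refine ⟨fun X Y _ _ _ _ f hf g => ?_⟩
  let _ : Module Sᵐᵒᵖᵐᵒᵖ X := Module.compHom X (RingEquiv.opOp S).symm.toRingHom
  let _ : Module Sᵐᵒᵖᵐᵒᵖ Y := Module.compHom Y (RingEquiv.opOp S).symm.toRingHom
  obtain ⟨k, hk⟩ := hQ.out (X := X) (Y := Y)
    { f with map_smul' := fun s x => map_smul f s.unop.unop x } hf
    { g with map_smul' := fun s x => (map_smul g s.unop.unop x).trans (hc _ _).symm }
  exact ⟨{ k with map_smul' := fun s x => (map_smul k (op (op s)) x).trans (hc _ _) }, hk⟩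

/-- Injectivity over `S` implies injectivity over `Sᵐᵒᵖᵐᵒᵖ`, for compatible actions. -/
theorem Module.Injective.opOp {S : Type u} [Ring S] {Q : Type u} [AddCommGroup Q]
    [Module S Q] [Module Sᵐᵒᵖᵐᵒᵖ Q] (hc : ∀ (s : S) (x : Q), op (op s) • x = s • x)
    (hQ : Module.Injective S Q) : Module.Injective Sᵐᵒᵖᵐᵒᵖ Q := by
  refine ⟨fun X Y _ _ _ _ f hf g => ?_⟩
  let _ : Module S X := Module.compHom X (RingEquiv.opOp S).toRingHom
  let _ : Module S Y := Module.compHom Y (RingEquiv.opOp S).toRingHom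
  obtain ⟨k, hk⟩ := hQ.out (X := X) (Y := Y)
    { f with map_smul' := fun s x => map_smul f (op (op s)) x } hf
    { g with map_smul' := fun s x => (map_smul g (op (op s)) x).trans (hc _ _) }
  exact ⟨{ k with map_smul' := fun s x => (map_smul k s.unop.unop x).trans (hc _ _).symm }, hk⟩

section RightIF

variable {R : Type u} [Ring R]

/-- Over a right IF ring, character modules of injective right modules are injective. -/
theorem IsLeftIF.injective_characterModule (hIF : IsLeftIF Rᵐᵒᵖ) {N : Type u} [AddCommGroup N]
    [Module Rᵐᵒᵖ N] (hN : Module.Injective Rᵐᵒᵖ N) : Module.Injective R (CharacterModule N) :=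
  Module.Injective.of_opOp (fun _ _ => rfl)
    ((isFlatMod_iff_injective_characterModule (ModuleCat.of Rᵐᵒᵖ N)).1 (hIF _ hN))

/-- Over a right IF ring, the cokernel of a monomorphism of flat left modules is flat. -/
theorem IsLeftIF.isFlatMod_of_exact (hIF : IsLeftIF Rᵐᵒᵖ) {H J X : ModuleCat.{u} R}
    (i : H →ₗ[R] J) (p : J →ₗ[R] X) (hi : Function.Injective i) (hp : Function.Surjective p)
    (hip : Function.Exact i p) (hH : IsFlatMod R H) (hJ : IsFlatMod R J) : IsFlatMod R X := by
  rw [isFlatMod_iff_injective_characterModule] at hH hJ ⊢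
  obtain ⟨ψ, hψ⟩ := (hIF.injective_characterModule hH).out i hi (CharacterModule.evalDouble R H)
  let σ : CharacterModule H →ₗ[Rᵐᵒᵖ] CharacterModule J :=
    { toFun c := AddMonoidHom.mk' (fun j => ψ j c) fun j j' => by
        rw [map_add, CharacterModule.add_apply']
      map_add' c c' := by ext j; exact map_add (ψ j) c c'
      map_smul' s c := by ext j; exact (DFunLike.congr_fun (map_smul ψ s.unop j) c).symm }
  have hσ (c : CharacterModule H) (h : H) : σ c (i h) = c h := DFunLike.congr_fun (hψ h) c
  let τ : CharacterModule J →ₗ[Rᵐᵒᵖ] CharacterModule J :=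
    LinearMap.id - σ.comp (CharacterModule.dualOp i)
  have hτ (c : CharacterModule J) (h : H) : τ c (i h) = 0 := by
    change (c - σ (CharacterModule.dualOp i c)) (i h) = 0
    rw [CharacterModule.sub_apply', hσ, CharacterModule.dualOp_apply, sub_self]
  have hex (c : CharacterModule J) : ∃ c' : CharacterModule X, ∀ j, c' (p j) = τ c j := by
    refine CharacterModule.exists_factor p.toAddMonoidHom (τ c) fun j hj => ?_
    obtain ⟨h, rfl⟩ := (hip j).1 hj
    exact hτ c h
  choose ρ hρ using hex
  refine hJ.of_retract (CharacterModule.dualOp p)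
    { toFun := ρ
      map_add' := fun c c' => ?_
      map_smul' := fun s c => ?_ } fun c => ?_
  · ext x
    obtain ⟨j, rfl⟩ := hp x
    rw [CharacterModule.add_apply', hρ, hρ, hρ, map_add, CharacterModule.add_apply']
  · ext x
    obtain ⟨j, rfl⟩ := hp x
    rw [RingHom.id_apply, CharacterModule.op_smul_apply', hρ, ← map_smul, hρ, map_smul,
      CharacterModule.op_smul_apply']
  · ext x
    obtain ⟨j, rfl⟩ := hp x
    refine (hρ _ j).trans ?_
    have h0 : CharacterModule.dualOp i (CharacterModule.dualOp p c) = 0 := by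
      ext h
      change c (p (i h)) = 0
      rw [hip.apply_apply_eq_zero, map_zero]
    change (CharacterModule.dualOp p c - σ (CharacterModule.dualOp i (CharacterModule.dualOp p c))) j
      = c (p j)
    rw [h0, map_zero, sub_zero, CharacterModule.dualOp_apply]

/-- Over a right coherent ring, if `N` is an injective right module whose character module is
injective, then this character module is flat. -/
theorem IsLeftCoherent.isFlatMod_characterModule (hcr : IsLeftCoherent Rᵐᵒᵖ) {N : Type u}
    [AddCommGroup N] [Module Rᵐᵒᵖ N] (hN : Module.Injective Rᵐᵒᵖ N)
    (hJ : Module.Injective R (CharacterModule N)) :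
    IsFlatMod R (ModuleCat.of R (CharacterModule N)) := by
  rw [isFlatMod_iff_injective_characterModule]
  refine Module.Baer.injective fun I f => ?_
  have key {m : ℕ} (a : Fin m → I) (x : Fin m → CharacterModule N)
      (hax : ∑ i, (a i).1.unop • x i = 0) : ∑ i, f (a i) (x i) = 0 := by
    let p : (Fin m → Rᵐᵒᵖ) →ₗ[Rᵐᵒᵖ] Rᵐᵒᵖ := Fintype.linearCombination Rᵐᵒᵖ fun i => (a i).1
    have hfg : (LinearMap.ker p).FG := by
      have hr : (LinearMap.range p).FG := by
        rw [LinearMap.range_eq_map]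
        exact Submodule.FG.map p Module.Finite.fg_top
      have := hcr _ hr
      have := Module.FinitePresentation.fg_ker p.rangeRestrict p.surjective_rangeRestrict
      rwa [LinearMap.ker_rangeRestrict] at this
    obtain ⟨k, s, hs⟩ := Submodule.fg_iff_exists_fin_generating_family.1 hfg
    have hsp (j : Fin k) : ∑ i, s j i * (a i).1 = 0 := by
      have : s j ∈ LinearMap.ker p := hs ▸ Submodule.subset_span ⟨j, rfl⟩
      simpa [p, Fintype.linearCombination_apply] using this
    let T : (Fin m → R) →ₗ[R] (Fin k → R) :=
      LinearMap.pi fun j => Fintype.linearCombination R fun i => (s j i).unop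
    let fx : (Fin m → R) →ₗ[R] CharacterModule N := Fintype.linearCombination R x
    have hker : LinearMap.ker T ≤ LinearMap.ker fx := by
      intro t ht
      have ht' (j : Fin k) : ∑ i, t i * (s j i).unop = 0 := by
        simpa [T, Fintype.linearCombination_apply] using congrFun (LinearMap.mem_ker.1 ht) j
      rw [LinearMap.mem_ker]
      ext n
      let q : (Fin m → Rᵐᵒᵖ) →ₗ[Rᵐᵒᵖ] N := Fintype.linearCombination Rᵐᵒᵖ fun i => op (t i) • n
      have hpq : LinearMap.ker p ≤ LinearMap.ker q := by
        rw [← hs, Submodule.span_le]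
        rintro _ ⟨j, rfl⟩
        have : ∑ i, s j i * op (t i) = 0 := unop_injective (by simpa using ht' j)
        simp [q, Fintype.linearCombination_apply, smul_smul, ← Finset.sum_smul, this]
      obtain ⟨h, hh⟩ := hN.exists_factor p q hpq
      have hat (i : Fin m) : op (t i) • n = (a i).1 • h 1 := by
        have := hh (Pi.single i 1)
        simp only [p, q, Fintype.linearCombination_apply_single, one_smul] at this
        rw [← this, ← map_smul, smul_eq_mul, mul_one]
      have := DFunLike.congr_fun hax (h 1)
      rw [CharacterModule.sum_apply] at this
      rw [Fintype.linearCombination_apply, CharacterModule.sum_apply]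
      refine (Finset.sum_congr rfl fun i _ => ?_).trans this
      rw [CharacterModule.smul_apply_op, hat]
      rfl
    obtain ⟨h, hh⟩ := hJ.exists_factor T fx hker
    have hx (i : Fin m) : x i = ∑ j, (s j i).unop • h (Pi.single j 1) := by
      have h1 := hh (Pi.single i 1)
      simp only [fx, Fintype.linearCombination_apply_single, one_smul] at h1
      rw [← h1, LinearMap.pi_apply_eq_sum_univ h]
      refine Finset.sum_congr rfl fun j _ => ?_
      congr 1
      · simp [T]
      · congr 1; ext l; simp [Pi.single_apply, eq_comm]
    calc ∑ i, f (a i) (x i)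
        = ∑ i, ∑ j, (s j i • f (a i)) (h (Pi.single j 1)) := by
          refine Finset.sum_congr rfl fun i _ => ?_
          rw [hx i, map_sum]
          rfl
      _ = ∑ j, f (∑ i, s j i • a i) (h (Pi.single j 1)) := by
          rw [Finset.sum_comm]
          refine Finset.sum_congr rfl fun j _ => ?_
          rw [map_sum, CharacterModule.sum_apply]
          simp_rw [map_smul]
      _ = 0 := by
          refine Finset.sum_eq_zero fun j _ => ?_
          have : ∑ i, s j i • a i = 0 := by
            ext1
            simpa using hsp j
          rw [this, map_zero]
          rfl
  let α : FreeAbelianGroup (I × CharacterModule N) →+ CharacterModule N :=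
    FreeAbelianGroup.lift fun q => q.1.1.unop • q.2
  let β : FreeAbelianGroup (I × CharacterModule N) →+ AddCircle (1 : ℚ) :=
    FreeAbelianGroup.lift fun q => f q.1 q.2
  have hrep (z : FreeAbelianGroup (I × CharacterModule N)) :
      ∃ (m : ℕ) (a : Fin m → I) (x : Fin m → CharacterModule N),
        α z = ∑ i, (a i).1.unop • x i ∧ β z = ∑ i, f (a i) (x i) := by
    induction z using FreeAbelianGroup.induction_on with
    | zero => exact ⟨0, Fin.elim0, Fin.elim0, by simp, by simp⟩
    | of q => exact ⟨1, fun _ => q.1, fun _ => q.2, by simp [α], by simp [β]⟩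
    | neg q _ => exact ⟨1, fun _ => q.1, fun _ => -q.2, by simp [α], by simp [β]⟩
    | add y z hy hz =>
      obtain ⟨m, a, x, h1, h2⟩ := hy
      obtain ⟨m', a', x', h1', h2'⟩ := hz
      refine ⟨m + m', Fin.append a a', Fin.append x x', ?_, ?_⟩
      · simp [Fin.sum_univ_add, h1, h1']
      · simp [Fin.sum_univ_add, h2, h2']
  obtain ⟨φ, hφ⟩ := CharacterModule.exists_factor α β fun z hz => by
    obtain ⟨m, a, x, h1, h2⟩ := hrep z
    exact h2.trans (key a x (h1.symm.trans hz))
  refine ⟨LinearMap.toSpanSingleton Rᵐᵒᵖ _ φ, fun r hr => ?_⟩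
  ext y
  have := hφ (FreeAbelianGroup.of (⟨r, hr⟩, y))
  rw [FreeAbelianGroup.lift_apply_of] at this
  exact this.trans (FreeAbelianGroup.lift_apply_of _ _)

/-- Over a right coherent right IF ring, every flat left module embeds into a flat injective
left module. -/
theorem IsLeftIF.exists_flat_injective (hIF : IsLeftIF Rᵐᵒᵖ) (hcr : IsLeftCoherent Rᵐᵒᵖ)
    {F : ModuleCat.{u} R} (hF : IsFlatMod R F) :
    ∃ (J : ModuleCat.{u} R) (i : F →ₗ[R] J), Function.Injective i ∧ IsFlatMod R J ∧
      Module.Injective R J := by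
  have hN := (isFlatMod_iff_injective_characterModule F).1 hF
  have hJ := hIF.injective_characterModule hN
  exact ⟨ModuleCat.of R (CharacterModule (CharacterModule F)), CharacterModule.evalDouble R F,
    CharacterModule.evalDouble_injective, hcr.isFlatMod_characterModule hN hJ, hJ⟩

end RightIF
section Coresolution

variable {R : Type u} [Ring R]

/-- A linear map vanishing on the kernel of a surjection descends along it. -/
theorem LinearMap.exists_descent {X Y Z : Type u} [AddCommGroup X] [AddCommGroup Y]
    [AddCommGroup Z] [Module R X] [Module R Y] [Module R Z] (p : X →ₗ[R] Y) (g : X →ₗ[R] Z)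
    (hp : Function.Surjective p) (h : ∀ x, p x = 0 → g x = 0) :
    ∃ k : Y →ₗ[R] Z, ∀ x, k (p x) = g x := by
  refine ⟨((LinearMap.ker p).liftQ g h).comp (p.quotKerEquivOfSurjective hp).symm.toLinearMap,
    fun x => ?_⟩
  have : (p.quotKerEquivOfSurjective hp).symm (p x) = Submodule.Quotient.mk x :=
    (LinearEquiv.symm_apply_eq _).2 rfl
  rw [LinearMap.comp_apply, LinearEquiv.coe_coe, this]
  exact Submodule.liftQ_apply _ _ _

theorem isFlatMod_prod {J₁ J₂ : ModuleCat.{u} R} (h₁ : IsFlatMod R J₁) (h₂ : IsFlatMod R J₂) :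
    IsFlatMod R (ModuleCat.of R (J₁ × J₂)) := by
  rw [isFlatMod_iff_injective_characterModule] at h₁ h₂ ⊢
  refine ⟨fun A B _ _ _ _ f hf g => ?_⟩
  obtain ⟨k₁, hk₁⟩ := h₁.out f hf ((CharacterModule.dualOp (LinearMap.inl R J₁ J₂)).comp g)
  obtain ⟨k₂, hk₂⟩ := h₂.out f hf ((CharacterModule.dualOp (LinearMap.inr R J₁ J₂)).comp g)
  refine ⟨(CharacterModule.dualOp (LinearMap.fst R J₁ J₂)).comp k₁ +
    (CharacterModule.dualOp (LinearMap.snd R J₁ J₂)).comp k₂, fun a => ?_⟩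
  ext ⟨x, y⟩
  have h1 : k₁ (f a) x = g a (x, 0) := DFunLike.congr_fun (hk₁ a) x
  have h2 : k₂ (f a) y = g a (0, y) := DFunLike.congr_fun (hk₂ a) y
  change k₁ (f a) x + k₂ (f a) y = g a (x, y)
  rw [h1, h2, ← map_add, Prod.mk_add_mk, add_zero, zero_add]

theorem Module.Injective.prod {P Q : Type u} [AddCommGroup P] [AddCommGroup Q] [Module R P]
    [Module R Q] (hP : Module.Injective R P) (hQ : Module.Injective R Q) :
    Module.Injective R (P × Q) := by
  refine ⟨fun A B _ _ _ _ f hf g => ?_⟩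
  obtain ⟨k₁, hk₁⟩ := hP.out f hf ((LinearMap.fst R P Q).comp g)
  obtain ⟨k₂, hk₂⟩ := hQ.out f hf ((LinearMap.snd R P Q).comp g)
  exact ⟨k₁.prod k₂, fun a => Prod.ext (hk₁ a) (hk₂ a)⟩

/-- `HasFlatInjectiveCoresolution R k M`: there is an exact sequence
`0 → M → J⁰ → ⋯ → Jᵏ⁻¹` of left modules with all `Jⁱ` flat and injective. -/
def HasFlatInjectiveCoresolution (R : Type u) [Ring R] : ℕ → ModuleCat.{u} R → Prop
  | 0, _ => True
  | k + 1, M => ∃ (J C : ModuleCat.{u} R) (i : M →ₗ[R] J) (p : J →ₗ[R] C),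
      Function.Injective i ∧ Function.Surjective p ∧ Function.Exact i p ∧
      IsFlatMod R J ∧ Module.Injective R J ∧ HasFlatInjectiveCoresolution R k C

/-- The quotient map onto the cokernel of a linear map is part of an exact sequence. -/
theorem LinearMap.exact_mkQ_range {X Y : Type u} [AddCommGroup X] [AddCommGroup Y]
    [Module R X] [Module R Y] (f : X →ₗ[R] Y) :
    Function.Exact f (LinearMap.range f).mkQ := fun y => by simp

namespace HasFlatInjectiveCoresolution

/-- The horseshoe lemma: modules with a flat injective coresolution are closed under
extensions. -/
theorem of_extension {k : ℕ} {A B C : ModuleCat.{u} R} (f : A →ₗ[R] B) (g : B →ₗ[R] C)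
    (hf : Function.Injective f) (hg : Function.Surjective g) (hfg : Function.Exact f g)
    (hA : HasFlatInjectiveCoresolution R k A) (hC : HasFlatInjectiveCoresolution R k C) :
    HasFlatInjectiveCoresolution R k B := by
  induction k generalizing A B C with
  | zero => trivial
  | succ k ih =>
    obtain ⟨J₁, C₁, i₁, p₁, hi₁, hp₁, hip₁, hF₁, hJ₁, hC₁⟩ := hA
    obtain ⟨J₂, C₂, i₂, p₂, hi₂, hp₂, hip₂, hF₂, hJ₂, hC₂⟩ := hC
    obtain ⟨ε, hε⟩ := hJ₁.out f hf i₁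
    let φ : B →ₗ[R] J₁ × J₂ := ε.prod (i₂.comp g)
    have hφ : Function.Injective φ := by
      refine (injective_iff_map_eq_zero _).2 fun b hb => ?_
      have hb₁ : ε b = 0 := congrArg Prod.fst hb
      have hb₂ : i₂ (g b) = 0 := congrArg Prod.snd hb
      obtain ⟨a, rfl⟩ := (hfg b).1 (hi₂ (hb₂.trans (map_zero i₂).symm))
      rw [hε] at hb₁
      rw [hi₁ (hb₁.trans (map_zero i₁).symm), map_zero]
    let q : J₁ × J₂ →ₗ[R] (J₁ × J₂) ⧸ LinearMap.range φ := (LinearMap.range φ).mkQ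
    have hq : Function.Surjective q := Submodule.mkQ_surjective _
    have hφq : Function.Exact φ q := φ.exact_mkQ_range
    refine ⟨ModuleCat.of R (J₁ × J₂), ModuleCat.of R ((J₁ × J₂) ⧸ LinearMap.range φ), φ, q,
      hφ, hq, hφq, isFlatMod_prod hF₁ hF₂, hJ₁.prod hJ₂, ?_⟩
    obtain ⟨v, hv⟩ := LinearMap.exists_descent p₁ (q.comp (LinearMap.inl R J₁ J₂)) hp₁ (by
      intro j hj
      obtain ⟨a, rfl⟩ := (hip₁ j).1 hj
      refine (hφq _).2 ⟨f a, Prod.ext (hε a) ?_⟩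
      change i₂ (g (f a)) = 0
      rw [hfg.apply_apply_eq_zero, map_zero])
    obtain ⟨w, hw⟩ := LinearMap.exists_descent q (p₂.comp (LinearMap.snd R J₁ J₂)) hq (by
      intro j hj
      obtain ⟨b, rfl⟩ := (hφq j).1 hj
      exact hip₂.apply_apply_eq_zero (g b))
    refine ih (A := C₁) (C := C₂) v w ?_ ?_ ?_ hC₁ hC₂
    · refine (injective_iff_map_eq_zero _).2 fun c hc => ?_
      obtain ⟨j, rfl⟩ := hp₁ c
      rw [hv] at hc
      obtain ⟨b, hb⟩ := (hφq _).1 hc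
      have hb₁ : ε b = j := congrArg Prod.fst hb
      have hb₂ : i₂ (g b) = 0 := congrArg Prod.snd hb
      obtain ⟨a, rfl⟩ := (hfg b).1 (hi₂ (hb₂.trans (map_zero i₂).symm))
      rw [← hb₁, hε, hip₁.apply_apply_eq_zero]
    · intro c
      obtain ⟨j, rfl⟩ := hp₂ c
      exact ⟨q (0, j), hw _⟩
    · intro z
      constructor
      · intro hz
        obtain ⟨⟨j₁, j₂⟩, rfl⟩ := hq z
        rw [hw] at hz
        obtain ⟨c, hc⟩ := (hip₂ j₂).1 hz
        obtain ⟨b, rfl⟩ := hg c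
        refine ⟨p₁ (j₁ - ε b), ?_⟩
        have hb : q (φ b) = 0 := hφq.apply_apply_eq_zero b
        rw [hv, ← sub_zero (q (j₁, j₂)), ← hb, ← map_sub]
        refine congrArg q (Prod.ext rfl ?_)
        change 0 = j₂ - i₂ (g b)
        rw [hc, sub_self]
      · rintro ⟨c, rfl⟩
        obtain ⟨j, rfl⟩ := hp₁ c
        rw [hv]
        exact (hw _).trans (map_zero p₂)

variable (hIF : IsLeftIF Rᵐᵒᵖ) (hcr : IsLeftCoherent Rᵐᵒᵖ)

include hIF hcr

theorem of_isFlatMod {F : ModuleCat.{u} R} (hF : IsFlatMod R F) (k : ℕ) :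
    HasFlatInjectiveCoresolution R k F := by
  induction k generalizing F with
  | zero => trivial
  | succ k ih =>
    obtain ⟨J, i, hi, hJ, hJ'⟩ := hIF.exists_flat_injective hcr hF
    refine ⟨J, ModuleCat.of R (J ⧸ LinearMap.range i), i, (LinearMap.range i).mkQ, hi,
      Submodule.mkQ_surjective _, i.exact_mkQ_range, hJ, hJ', ih ?_⟩
    exact hIF.isFlatMod_of_exact i (LinearMap.range i).mkQ hi (Submodule.mkQ_surjective _)
      i.exact_mkQ_range hF hJ

/-- A coresolution may begin with a module which is merely flat. -/
theorem succ_of_isFlatMod {k : ℕ} {M F C : ModuleCat.{u} R} (a : M →ₗ[R] F) (b : F →ₗ[R] C)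
    (ha : Function.Injective a) (hb : Function.Surjective b) (hab : Function.Exact a b)
    (hF : IsFlatMod R F) (hC : HasFlatInjectiveCoresolution R k C) :
    HasFlatInjectiveCoresolution R (k + 1) M := by
  obtain ⟨J, i, hi, hJ, hJ'⟩ := hIF.exists_flat_injective hcr hF
  let q := (LinearMap.range (i.comp a)).mkQ
  have hq : Function.Surjective q := Submodule.mkQ_surjective _
  have haq : Function.Exact (i.comp a) q := (i.comp a).exact_mkQ_range
  let r := (LinearMap.range i).mkQ
  have hr : Function.Surjective r := Submodule.mkQ_surjective _
  have hir : Function.Exact i r := i.exact_mkQ_range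
  refine ⟨J, ModuleCat.of R (J ⧸ LinearMap.range (i.comp a)), i.comp a, q, hi.comp ha, hq, haq,
    hJ, hJ', ?_⟩
  obtain ⟨v, hv⟩ := LinearMap.exists_descent b (q.comp i) hb (by
    intro x hx
    obtain ⟨m, rfl⟩ := (hab x).1 hx
    exact haq.apply_apply_eq_zero m)
  obtain ⟨w, hw⟩ := LinearMap.exists_descent q r hq (by
    intro x hx
    obtain ⟨m, rfl⟩ := (haq x).1 hx
    exact hir.apply_apply_eq_zero _)
  refine of_extension (A := C) (C := ModuleCat.of R (J ⧸ LinearMap.range i)) v w ?_ ?_ ?_ hC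
    (of_isFlatMod hIF hcr (hIF.isFlatMod_of_exact i r hi hr hir hF hJ) k)
  · refine (injective_iff_map_eq_zero _).2 fun c hc => ?_
    obtain ⟨x, rfl⟩ := hb c
    rw [hv] at hc
    obtain ⟨m, hm⟩ := (haq _).1 hc
    rw [← hi hm, hab.apply_apply_eq_zero]
  · intro c
    obtain ⟨j, rfl⟩ := hr c
    exact ⟨q j, hw _⟩
  · intro z
    constructor
    · intro hz
      obtain ⟨j, rfl⟩ := hq z
      rw [hw] at hz
      obtain ⟨x, rfl⟩ := (hir j).1 hz
      exact ⟨b x, hv x⟩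
    · rintro ⟨c, rfl⟩
      obtain ⟨x, rfl⟩ := hb c
      rw [hv]
      exact (hw _).trans (hir.apply_apply_eq_zero x)

theorem of_prod {k : ℕ} {H M : ModuleCat.{u} R} (hH : IsFlatMod R H)
    (h : HasFlatInjectiveCoresolution R k (ModuleCat.of R (H × M))) :
    HasFlatInjectiveCoresolution R k M := by
  cases k with
  | zero => trivial
  | succ k =>
    obtain ⟨J, C, i, p, hi, hp, hip, hJ, hJ', hC⟩ := h
    let a : M →ₗ[R] J := i.comp (LinearMap.inr R H M)
    let b : H →ₗ[R] J := i.comp (LinearMap.inl R H M)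
    have hpa (m : M) : p (a m) = 0 := hip.apply_apply_eq_zero _
    have hpb (x : H) : p (b x) = 0 := hip.apply_apply_eq_zero _
    let q := (LinearMap.range a).mkQ
    have hq : Function.Surjective q := Submodule.mkQ_surjective _
    have haq : Function.Exact a q := a.exact_mkQ_range
    refine ⟨J, ModuleCat.of R (J ⧸ LinearMap.range a), a, q,
      hi.comp LinearMap.inr_injective, hq, haq, hJ, hJ', ?_⟩
    obtain ⟨w, hw⟩ := LinearMap.exists_descent q p hq (by
      intro x hx
      obtain ⟨m, rfl⟩ := (haq x).1 hx
      exact hpa m)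
    refine of_extension (A := H) (C := C) (q.comp b) w ?_ ?_ ?_ (of_isFlatMod hIF hcr hH k) hC
    · refine (injective_iff_map_eq_zero _).2 fun x hx => ?_
      obtain ⟨m, hm⟩ := (haq _).1 hx
      exact (congrArg Prod.fst (hi hm)).symm
    · intro c
      obtain ⟨j, rfl⟩ := hp c
      exact ⟨q j, hw _⟩
    · intro z
      constructor
      · intro hz
        obtain ⟨j, rfl⟩ := hq z
        rw [hw] at hz
        obtain ⟨⟨x, m⟩, rfl⟩ := (hip j).1 hz
        have h0 : q (a m) = 0 := haq.apply_apply_eq_zero m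
        refine ⟨x, ?_⟩
        rw [LinearMap.comp_apply, ← add_zero (q (b x)), ← h0, ← map_add]
        refine congrArg q ((map_add i _ _).symm.trans (congrArg i ?_))
        exact Prod.ext (add_zero x) (zero_add m)
      · rintro ⟨x, rfl⟩
        exact (hw _).trans (hpb x)

theorem of_quotient {k : ℕ} {K G M : ModuleCat.{u} R} (ι : K →ₗ[R] G) (π : G →ₗ[R] M)
    (hι : Function.Injective ι) (hπ : Function.Surjective π) (hιπ : Function.Exact ι π)
    (hK : HasFlatInjectiveCoresolution R (k + 1) K)
    (hG : HasFlatInjectiveCoresolution R k G) : HasFlatInjectiveCoresolution R k M := by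
  obtain ⟨H, L, i, p, hi, hp, hip, hF, hH, hL⟩ := hK
  obtain ⟨φ, hφ⟩ := hH.out ι hι i
  obtain ⟨θ, hθ⟩ := LinearMap.exists_descent π (p.comp φ) hπ (by
    intro g hg
    obtain ⟨x, rfl⟩ := (hιπ g).1 hg
    rw [LinearMap.comp_apply, hφ, hip.apply_apply_eq_zero])
  let w : H × M →ₗ[R] L := p.comp (LinearMap.fst R H M) - θ.comp (LinearMap.snd R H M)
  have hw (h : H) (m : M) : w (h, m) = p h - θ m := rfl
  refine of_prod hIF hcr hF
    (of_extension (A := G) (B := ModuleCat.of R (H × M)) (C := L) (φ.prod π) w ?_ ?_ ?_ hG hL)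
  · refine (injective_iff_map_eq_zero _).2 fun g hg => ?_
    have hg₁ : φ g = 0 := congrArg Prod.fst hg
    obtain ⟨x, rfl⟩ := (hιπ g).1 (congrArg Prod.snd hg)
    rw [hφ] at hg₁
    rw [hi (hg₁.trans (map_zero i).symm), map_zero]
  · intro l
    obtain ⟨h, rfl⟩ := hp l
    exact ⟨(h, 0), by rw [hw, map_zero, sub_zero]⟩
  · rintro ⟨h, m⟩
    constructor
    · intro hz
      obtain ⟨g, rfl⟩ := hπ m
      rw [hw, hθ, LinearMap.comp_apply, ← map_sub] at hz
      obtain ⟨x, hx⟩ := (hip _).1 hz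
      refine ⟨g + ι x, Prod.ext ?_ ?_⟩
      · change φ (g + ι x) = h
        rw [map_add, hφ, hx, add_sub_cancel]
      · change π (g + ι x) = π g
        rw [map_add, hιπ.apply_apply_eq_zero, add_zero]
    · rintro ⟨g, hg⟩
      rw [← hg]
      change p (φ g) - θ (π g) = 0
      rw [hθ, LinearMap.comp_apply, sub_self]

end HasFlatInjectiveCoresolution

/-- A cycle of an exact sequence is a quotient of a term by the previous cycle. -/
theorem exact_subtype_range_of_exact {X Y Z M : Type u} [AddCommGroup X] [AddCommGroup Y]
    [AddCommGroup Z] [AddCommGroup M] [Module R X] [Module R Y] [Module R Z] [Module R M]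
    {f : X →ₗ[R] Y} {g : Y →ₗ[R] Z} (h : Function.Exact f g) (e : LinearMap.range g ≃ₗ[R] M) :
    Function.Surjective (e.toLinearMap.comp g.rangeRestrict) ∧
      Function.Exact (LinearMap.range f).subtype (e.toLinearMap.comp g.rangeRestrict) := by
  refine ⟨e.surjective.comp g.surjective_rangeRestrict, fun y => ?_⟩
  have : e.toLinearMap.comp g.rangeRestrict y = 0 ↔ g y = 0 := by
    simp [Subtype.ext_iff]
  rw [this, h y]
  simp

section

variable (hIF : IsLeftIF Rᵐᵒᵖ) (hcr : IsLeftCoherent Rᵐᵒᵖ)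

include hIF hcr

theorem IsGorensteinFlat.hasFlatInjectiveCoresolution {M : ModuleCat.{u} R}
    (hM : IsGorensteinFlat R M) (k : ℕ) : HasFlatInjectiveCoresolution R k M := by
  obtain ⟨F, d, hF, hd, ⟨e⟩, -⟩ := hM
  generalize (0 : ℤ) = n at e
  induction k generalizing M n with
  | zero => trivial
  | succ k ih =>
    obtain ⟨hs, hex⟩ := exact_subtype_range_of_exact (hd n) (LinearEquiv.refl R _)
    refine HasFlatInjectiveCoresolution.succ_of_isFlatMod hIF hcr
      (C := ModuleCat.of R (LinearMap.range (d (n + 1))))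
      ((LinearMap.range (d n)).subtype.comp e.toLinearMap) _
      ((Submodule.subtype_injective _).comp e.injective) hs ?_ (hF _)
      (ih _ (LinearEquiv.refl R _))
    intro y
    rw [hex y]
    exact ⟨fun ⟨x, hx⟩ => ⟨e.symm x, by simpa using hx⟩, fun ⟨x, hx⟩ => ⟨e x, hx⟩⟩

theorem gflatDimLE.hasFlatInjectiveCoresolution {n : ℕ} {M : ModuleCat.{u} R}
    (hM : gflatDimLE R n M) (k : ℕ) : HasFlatInjectiveCoresolution R k M := by
  induction n generalizing M k with
  | zero => exact IsGorensteinFlat.hasFlatInjectiveCoresolution hIF hcr hM k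
  | succ n ih =>
    obtain ⟨K, G, ι, π, hι, hπ, hιπ, hG, hK⟩ := hM
    exact HasFlatInjectiveCoresolution.of_quotient hIF hcr ι π hι hπ hιπ (ih hK _)
      (hG.hasFlatInjectiveCoresolution hIF hcr k)

/-- Over a right coherent right IF ring, injective left modules of finite Gorenstein flat
dimension are flat. -/
theorem gflatDimLE.isFlatMod_of_injective {n : ℕ} {E : ModuleCat.{u} R}
    (h : gflatDimLE R n E) (hE : Module.Injective R E) : IsFlatMod R E := by
  obtain ⟨J, -, i, -, hi, -, -, hJ, -⟩ := h.hasFlatInjectiveCoresolution hIF hcr 1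
  obtain ⟨r, hr⟩ := hE.out i hi LinearMap.id
  rw [isFlatMod_iff_injective_characterModule] at hJ ⊢
  refine hJ.of_retract (CharacterModule.dualOp r) (CharacterModule.dualOp i) fun c => ?_
  ext x
  exact congrArg c (hr x)

end

end Coresolution

section Ext

open CategoryTheory CategoryTheory.Abelian

variable {S : Type u} [Ring S]

section Dimension

variable {K G N : ModuleCat.{u} S} (ι : K →ₗ[S] G) (π : G →ₗ[S] N)
  (hι : Function.Injective ι) (hπ : Function.Surjective π) (hιπ : Function.Exact ι π)
  (D : ModuleCat.{u} S)

include hι hπ hιπ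

/-- The short exact sequence of modules attached to an exact pair of linear maps. -/
theorem exists_shortExact :
    ∃ w, (ShortComplex.mk (ModuleCat.ofHom ι) (ModuleCat.ofHom π) w).ShortExact :=
  ⟨by ext x; exact hιπ.apply_apply_eq_zero x,
    ModuleCat.shortComplex_shortExact _ hιπ hι hπ⟩

theorem subsingleton_ext_right {n : ℕ} (hG : Subsingleton (Ext G D (n + 1)))
    (hK : Subsingleton (Ext K D n)) : Subsingleton (Ext N D (n + 1)) := by
  obtain ⟨w, hS⟩ := exists_shortExact ι π hι hπ hιπ
  refine subsingleton_of_forall_eq 0 fun x => ?_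
  obtain ⟨y, rfl⟩ := Ext.contravariant_sequence_exact₃ hS D x (Subsingleton.elim _ _)
    (add_comm 1 n)
  rw [Subsingleton.elim y 0, Ext.comp_zero]

theorem subsingleton_ext_one_right (hG : Subsingleton (Ext G D 1))
    (hK : ∀ f : K →ₗ[S] D, ∃ g : G →ₗ[S] D, ∀ x, g (ι x) = f x) :
    Subsingleton (Ext N D 1) := by
  obtain ⟨w, hS⟩ := exists_shortExact ι π hι hπ hιπ
  refine subsingleton_of_forall_eq 0 fun x => ?_
  obtain ⟨y, rfl⟩ := Ext.contravariant_sequence_exact₃ hS D x (Subsingleton.elim _ _)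
    (add_zero 1)
  obtain ⟨f, rfl⟩ := Ext.homEquiv₀.symm.surjective y
  obtain ⟨g, hg⟩ := hK f.hom
  have hfg : f = ModuleCat.ofHom ι ≫ ModuleCat.ofHom g := by
    ext x
    exact (hg x).symm
  subst hfg
  change hS.extClass.comp (Ext.mk₀ (ModuleCat.ofHom ι ≫ ModuleCat.ofHom g)) _ = 0
  rw [← Ext.mk₀_comp_mk₀]
  exact hS.extClass_comp_assoc _

theorem subsingleton_ext_left {n : ℕ} (hG : Subsingleton (Ext G D n))
    (hN : Subsingleton (Ext N D (n + 1))) : Subsingleton (Ext K D n) := by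
  obtain ⟨w, hS⟩ := exists_shortExact ι π hι hπ hιπ
  refine subsingleton_of_forall_eq 0 fun x => ?_
  obtain ⟨y, rfl⟩ := Ext.contravariant_sequence_exact₁ hS D x (add_comm 1 n)
    (Subsingleton.elim _ _)
  rw [Subsingleton.elim y 0, Ext.comp_zero]

end Dimension

/-- The dual of a short exact sequence ending in a flat module splits. -/
theorem IsFlatMod.exists_splitting {K Q P : ModuleCat.{u} S} (ι : K →ₗ[S] Q) (π : Q →ₗ[S] P)
    (hι : Function.Injective ι) (hπ : Function.Surjective π) (hιπ : Function.Exact ι π)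
    (hP : IsFlatMod S P) :
    ∃ s : CharacterModule K →ₗ[Sᵐᵒᵖ] CharacterModule Q, ∀ c k, s c (ι k) = c k := by
  rw [isFlatMod_iff_injective_characterModule] at hP
  have hinj : Function.Injective (CharacterModule.dualOp π) := fun c c' h => by
    ext x
    obtain ⟨y, rfl⟩ := hπ x
    exact DFunLike.congr_fun h y
  obtain ⟨r, hr⟩ := hP.out (CharacterModule.dualOp π) hinj LinearMap.id
  have hsurj : Function.Surjective (CharacterModule.dualOp ι) := fun c => by
    obtain ⟨c', hc'⟩ := CharacterModule.exists_extension ι.toAddMonoidHom hι c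
    exact ⟨c', by ext x; exact hc' x⟩
  obtain ⟨s, hs⟩ := LinearMap.exists_descent (CharacterModule.dualOp ι)
    (LinearMap.id - (CharacterModule.dualOp π).comp r) hsurj (by
      intro c hc
      obtain ⟨c', hc'⟩ := CharacterModule.exists_factor π.toAddMonoidHom c (by
        intro y hy
        obtain ⟨k, rfl⟩ := (hιπ y).1 hy
        exact DFunLike.congr_fun hc k)
      obtain rfl : CharacterModule.dualOp π c' = c := by ext y; exact hc' y
      rw [LinearMap.sub_apply, LinearMap.comp_apply, hr]
      exact sub_self _)
  refine ⟨s, fun c k => ?_⟩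
  obtain ⟨c, rfl⟩ := hsurj c
  rw [hs]
  change (c - CharacterModule.dualOp π (r c)) (ι k) = c (ι k)
  rw [CharacterModule.sub_apply', CharacterModule.dualOp_apply, hιπ.apply_apply_eq_zero, map_zero,
    sub_zero]

theorem isFlatMod_of_projective (Q : ModuleCat.{u} S) [Module.Projective S Q] :
    IsFlatMod S Q := by
  rw [isFlatMod_iff_injective_characterModule]
  refine ⟨fun A B _ _ _ _ f hf g => ?_⟩
  let p : CharacterModule B →ₗ[S] CharacterModule A :=
    { toFun c := AddMonoidHom.comp c f.toAddMonoidHom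
      map_add' _ _ := rfl
      map_smul' s c := by ext x; exact congrArg c (map_smul f (op s) x).symm }
  have hp : Function.Surjective p := fun c => by
    obtain ⟨c', hc'⟩ := CharacterModule.exists_extension f.toAddMonoidHom hf c
    exact ⟨c', by ext x; exact hc' x⟩
  obtain ⟨h, hh⟩ := Module.projective_lifting_property p
    (NTensor.curryRight (NTensor.lift g)) hp
  refine ⟨NTensor.curry (NTensor.liftRight h), fun a => ?_⟩
  ext q
  rw [NTensor.curry_apply, NTensor.liftRight_tmul]
  have := DFunLike.congr_fun (LinearMap.congr_fun hh q) a
  rw [NTensor.curryRight_apply, NTensor.lift_tmul] at this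
  exact this

/-- A flat module has a projective presentation with flat kernel. -/
theorem IsFlatMod.exists_presentation {P : ModuleCat.{u} S} (hP : IsFlatMod S P) :
    ∃ (K Q : ModuleCat.{u} S) (ι : K →ₗ[S] Q) (π : Q →ₗ[S] P), Function.Injective ι ∧
      Function.Surjective π ∧ Function.Exact ι π ∧ Projective Q ∧ IsFlatMod S K := by
  let π : (P →₀ S) →ₗ[S] P := Finsupp.linearCombination S id
  have hπ : Function.Surjective π := fun x => ⟨Finsupp.single x 1, by simp [π]⟩
  have hι : Function.Injective (LinearMap.ker π).subtype := Submodule.subtype_injective _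
  have hex : Function.Exact (LinearMap.ker π).subtype π := π.exact_subtype_ker_map
  refine ⟨ModuleCat.of S (LinearMap.ker π), ModuleCat.of S (P →₀ S), (LinearMap.ker π).subtype, π,
    hι, hπ, hex, ModuleCat.projective_of_free Finsupp.basisSingleOne, ?_⟩
  obtain ⟨s, hs⟩ := hP.exists_splitting (K := ModuleCat.of S (LinearMap.ker π))
    (Q := ModuleCat.of S (P →₀ S)) (LinearMap.ker π).subtype π hι hπ hex
  have hQ := isFlatMod_of_projective (ModuleCat.of S (P →₀ S))
  rw [isFlatMod_iff_injective_characterModule] at hQ ⊢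
  exact hQ.of_retract s (CharacterModule.dualOp (LinearMap.ker π).subtype) fun c => by
    ext k; exact hs c k

section CharacterModule

variable (E : Type u) [AddCommGroup E] [Module Sᵐᵒᵖ E]

/-- Character modules are cotorsion in the strong sense that all higher `Ext` groups from flat
modules vanish. -/
theorem IsFlatMod.subsingleton_ext {P : ModuleCat.{u} S} (hP : IsFlatMod S P) (i : ℕ) :
    Subsingleton (Ext P (ModuleCat.of S (CharacterModule E)) (i + 1)) := by
  induction i generalizing P with
  | zero =>
    obtain ⟨K, Q, ι, π, hι, hπ, hιπ, _, -⟩ := hP.exists_presentation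
    obtain ⟨s, hs⟩ := hP.exists_splitting ι π hι hπ hιπ
    refine subsingleton_ext_one_right ι π hι hπ hιπ _ (Ext.subsingleton_of_projective _ _ _)
      fun f => ⟨NTensor.curryRight
        (NTensor.lift (s.comp (NTensor.curry (NTensor.liftRight f)))), fun x => ?_⟩
    ext e
    rw [NTensor.curryRight_apply, NTensor.lift_tmul, LinearMap.comp_apply, hs,
      NTensor.curry_apply, NTensor.liftRight_tmul]
  | succ i ih =>
    obtain ⟨K, Q, ι, π, hι, hπ, hιπ, _, hK⟩ := hP.exists_presentation
    exact subsingleton_ext_right ι π hι hπ hιπ _ (Ext.subsingleton_of_projective _ _ _) (ih hK)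

/-- Over a left IF ring, a character module of finite injective dimension is injective. -/
theorem IsLeftIF.injective_characterModule_of_subsingleton_ext (hIF : IsLeftIF S) (n : ℕ)
    (h : ∀ A : ModuleCat.{u} S,
      Subsingleton (Ext A (ModuleCat.of S (CharacterModule E)) (n + 1))) :
    Module.Injective S (CharacterModule E) := by
  induction n with
  | zero =>
    exact (Module.injective_iff_injective_object S (CharacterModule E)).2
      ((injective_iff_subsingleton_ext_one).2 fun {A} => h A)
  | succ n ih =>
    refine ih fun A => ?_
    let J : ModuleCat.{u} S := Injective.under A
    have hJ : IsFlatMod S J := hIF _ ((Module.injective_iff_injective_object S J).2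
      (inferInstanceAs (Injective (Injective.under A))))
    let i : A →ₗ[S] J := (Injective.ι A).hom
    have hi : Function.Injective i :=
      (ModuleCat.mono_iff_injective (Injective.ι A)).1 inferInstance
    exact subsingleton_ext_left i (N := ModuleCat.of S (J ⧸ LinearMap.range i))
      (LinearMap.range i).mkQ hi (Submodule.mkQ_surjective _) i.exact_mkQ_range _
      (hJ.subsingleton_ext E n) (h _)

variable (hE : Module.Injective Sᵐᵒᵖ E)

include hE

/-- `Ext` groups from Gorenstein flat modules to character modules of injective modules
vanish. -/
theorem IsGorensteinFlat.subsingleton_ext {M : ModuleCat.{u} S} (hM : IsGorensteinFlat S M)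
    (i : ℕ) : Subsingleton (Ext M (ModuleCat.of S (CharacterModule E)) (i + 1)) := by
  obtain ⟨F, d, hF, hd, ⟨e⟩, hT⟩ := hM
  generalize (0 : ℤ) = n at e
  induction i generalizing M n with
  | zero =>
    obtain ⟨l, rfl⟩ : ∃ l : ℤ, n = l + 1 + 1 := ⟨n - 2, by ring⟩
    obtain ⟨hs, hex⟩ := exact_subtype_range_of_exact (hd (l + 1)) e.symm
    refine subsingleton_ext_one_right
      (K := ModuleCat.of S (LinearMap.range (d (l + 1)))) (G := F (l + 1 + 1)) _ _
      (Submodule.subtype_injective _) hs hex _ ((hF _).subsingleton_ext E 0) fun f => ?_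
    obtain ⟨c, hc⟩ := CharacterModule.exists_factor (NTensor.rmap E (d (l + 1)))
      (NTensor.liftRight (f.comp (d (l + 1)).rangeRestrict)) (by
        intro x hx
        obtain ⟨y, rfl⟩ := (hT E hE l x).1 hx
        have h0 : CharacterModule.dual (NTensor.rmap E (d l)).toIntLinearMap
            (NTensor.liftRight (f.comp (d (l + 1)).rangeRestrict)) = 0 := by
          refine NTensor.characterModule_congr fun a m => ?_
          change NTensor.liftRight (f.comp (d (l + 1)).rangeRestrict)
            (NTensor.rmap E (d l) (NTensor.tmul a m)) = 0
          have hz : (d (l + 1)).rangeRestrict (d l m) = 0 :=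
            Subtype.ext ((hd l).apply_apply_eq_zero m)
          rw [NTensor.rmap_tmul, NTensor.liftRight_tmul, LinearMap.comp_apply, hz, map_zero]
          rfl
        exact DFunLike.congr_fun h0 y)
    refine ⟨NTensor.curryRight c, ?_⟩
    rintro ⟨_, x, rfl⟩
    ext a
    have := hc (NTensor.tmul a x)
    rw [NTensor.rmap_tmul, NTensor.liftRight_tmul] at this
    exact this
  | succ i ih =>
    obtain ⟨m, rfl⟩ : ∃ m : ℤ, n = m + 1 := ⟨n - 1, by ring⟩
    obtain ⟨hs, hex⟩ := exact_subtype_range_of_exact (hd m) e.symm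
    exact subsingleton_ext_right (K := ModuleCat.of S (LinearMap.range (d m)))
      (G := F (m + 1)) _ _ (Submodule.subtype_injective _) hs hex _
      ((hF _).subsingleton_ext E _) (ih m (LinearEquiv.refl S _))

theorem gflatDimLE.subsingleton_ext {n : ℕ} {M : ModuleCat.{u} S} (hM : gflatDimLE S n M)
    (i : ℕ) (hi : n ≤ i) : Subsingleton (Ext M (ModuleCat.of S (CharacterModule E)) (i + 1)) := by
  induction n generalizing M i with
  | zero => exact IsGorensteinFlat.subsingleton_ext E hE hM i
  | succ n ih =>
    obtain ⟨K, G, ι, π, hι, hπ, hιπ, hG, hK⟩ := hM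
    obtain ⟨i, rfl⟩ : ∃ j, i = j + 1 := ⟨i - 1, by omega⟩
    exact subsingleton_ext_right ι π hι hπ hιπ _ (hG.subsingleton_ext E hE _)
      (ih hK _ (by omega))

end CharacterModule

end Ext

/-- Over a right IF ring, if the Gorenstein flat dimensions of right modules are bounded, then
injective left modules are flat. -/
theorem IsLeftIF.isLeftIF_of_gflatDimLE {R : Type u} [Ring R] (hIF : IsLeftIF Rᵐᵒᵖ) (n : ℕ)
    (h : ∀ M : ModuleCat.{u} Rᵐᵒᵖ, ∃ m ≤ n, gflatDimLE Rᵐᵒᵖ m M) : IsLeftIF R := by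
  intro E hE
  let _ : Module Rᵐᵒᵖᵐᵒᵖ E := Module.compHom E (RingEquiv.opOp R).symm.toRingHom
  have hE' : Module.Injective Rᵐᵒᵖᵐᵒᵖ E := hE.opOp fun _ _ => rfl
  rw [isFlatMod_iff_injective_characterModule]
  exact hIF.injective_characterModule_of_subsingleton_ext E n fun A => by
    obtain ⟨m, hm, hA⟩ := h A
    exact hA.subsingleton_ext E hE' n hm

theorem exists_gflatDimLE_of_gorensteinWeakGlobalDim_ne_top {S : Type u} [Ring S]
    (h : gorensteinWeakGlobalDim S ≠ ⊤) :
    ∃ n : ℕ, ∀ M : ModuleCat.{u} S, ∃ m ≤ n, gflatDimLE S m M := by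
  obtain ⟨n, hn⟩ := ENat.ne_top_iff_exists.1 h
  refine ⟨n, fun M => ?_⟩
  have hM : gflatDim S M < (n + 1 : ℕ) := by
    refine (le_iSup (gflatDim S) M).trans_lt ?_
    change gorensteinWeakGlobalDim S < _
    rw [← hn]
    exact_mod_cast n.lt_succ_self
  obtain ⟨_, ⟨m, rfl, hm⟩, hmn⟩ := sInf_lt_iff.1 hM
  exact ⟨m, Nat.lt_succ_iff.1 (by exact_mod_cast hmn), hm⟩

end

/-- **Remark 2.10.**  If `R` is a left and right coherent ring which is right IF but not left
IF, then `l.Gwdim(R) = r.Gwdim(R) = ∞`.  (Right IF means every injective right `R`-module is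
flat, i.e. `Rᵐᵒᵖ` is left IF.) -/
theorem gorensteinWeakGlobalDim_eq_top_of_rightIF_not_leftIF (R : Type u) [Ring R]
    (hcl : IsLeftCoherent R) (hcr : IsLeftCoherent Rᵐᵒᵖ)
    (hIF : IsLeftIF Rᵐᵒᵖ) (hnIF : ¬ IsLeftIF R) :
    gorensteinWeakGlobalDim R = ⊤ ∧ gorensteinWeakGlobalDim Rᵐᵒᵖ = ⊤ := by
  refine ⟨by_contra fun h => hnIF fun E hE => ?_, by_contra fun h => hnIF ?_⟩
  · obtain ⟨n, hn⟩ := exists_gflatDimLE_of_gorensteinWeakGlobalDim_ne_top h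
    obtain ⟨m, -, hm⟩ := hn E
    exact hm.isFlatMod_of_injective hIF hcr hE
  · obtain ⟨n, hn⟩ := exists_gflatDimLE_of_gorensteinWeakGlobalDim_ne_top h
    exact hIF.isLeftIF_of_gflatDimLE n hn
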